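/- Let Γ = {θ = (θ₁, θ₂, …) ∈ ℓ²(ℕ) : Σ_{i≥1} i·|θ_i| ≤ 1}. There exist constants c > 0, C > 0 and ε₀ ∈ (0,1) such that for every ε ∈ (0, ε₀), c·ε^{−12/5} ≤ n_gof(Γ, ε) ≤ C·ε^{−12/5}·log(1/ε). In particular, n_gof(Γ, ε) > ε^{−12/5}/64 and n_gof(Γ, ε) ≤ ε^{−12/5}·log(16/ε) for all sufficiently small ε. -/

import Mathlib

open MeasureTheory ProbabilityTheory Real
open scoped RealInnerProductSpace ENNReal

/-- The real Hilbert space `ℓ²(ℕ)` of square-summable sequences. -/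
noncomputable abbrev SeqL2 : Type := lp (fun _ : ℕ => ℝ) 2

/-- The joint law of `n` i.i.d. samples from `ν`. -/
noncomputable def iidSamples {E : Type*} [MeasurableSpace E] (n : ℕ) (ν : Measure E) :
    Measure (Fin n → E) :=
  Measure.pi (fun _ => ν)

/-- `ν` is the Gaussian sequence measure `N(θ, I_∞) = ⊗_{i ≥ 0} N(θ_i, 1)` on `ℝ^ℕ`:
a probability measure whose finite-dimensional marginals are the corresponding finite
product Gaussians.  (Such a measure exists and is unique.) -/
def IsGaussianSeq (θ : ℕ → ℝ) (ν : Measure (ℕ → ℝ)) : Prop :=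
  IsProbabilityMeasure ν ∧
    IsProjectiveLimit ν (fun J : Finset ℕ => Measure.pi (fun j : J => gaussianReal (θ j) 1))

/-- Goodness-of-fit sample complexity in the Gaussian sequence model, where
`G θ = N(θ, I_∞)`: the smallest `n` admitting a measurable test with both errors `≤ 1/4`. -/
noncomputable def nGofSeq (G : (ℕ → ℝ) → Measure (ℕ → ℝ)) (Γ : Set SeqL2) (ε : ℝ) : ℕ :=
  sInf {n : ℕ | ∃ ψ : (Fin n → (ℕ → ℝ)) → Bool, Measurable ψ ∧
    (iidSamples n (G 0)) {x | ψ x = true} ≤ 1/4 ∧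
    ∀ θ ∈ Γ, ε ≤ ‖θ‖ → (iidSamples n (G ⇑θ)) {x | ψ x = false} ≤ 1/4}

/-- Estimation sample complexity in the Gaussian sequence model, where `G θ = N(θ, I_∞)`:
the smallest `n` admitting a measurable estimator with worst-case expected squared
`ℓ²`-error at most `ε²` over `Γ`. -/
noncomputable def nEstSeq (G : (ℕ → ℝ) → Measure (ℕ → ℝ)) (Γ : Set SeqL2) (ε : ℝ) : ℕ :=
  sInf {n : ℕ | ∃ est : (Fin n → (ℕ → ℝ)) → (ℕ → ℝ), Measurable est ∧
    ∀ θ ∈ Γ,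
      (∫⁻ x, (∑' i, ENNReal.ofReal ((est x i - θ i) ^ 2)) ∂(iidSamples n (G ⇑θ)))
        ≤ ENNReal.ofReal (ε ^ 2)}

/-- `(m, n)` is LFHT-feasible for `Γ ⊆ ℓ²(ℕ)` at separation `ε` in the Gaussian sequence
model, where `G θ = N(θ, I_∞)`. -/
def LFHTFeasibleSeq (G : (ℕ → ℝ) → Measure (ℕ → ℝ)) (Γ : Set SeqL2) (ε : ℝ)
    (m n : ℕ) : Prop :=
  ∃ ψ : (Fin n → (ℕ → ℝ)) × (Fin n → (ℕ → ℝ)) × (Fin m → (ℕ → ℝ)) → Bool,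
    Measurable ψ ∧
    ∀ θ1 ∈ Γ, ∀ θ2 ∈ Γ, ε ≤ ‖θ1 - θ2‖ →
      (((iidSamples n (G ⇑θ1)).prod
          ((iidSamples n (G ⇑θ2)).prod (iidSamples m (G ⇑θ1))))
            {x | ψ x = true} ≤ 1/4 ∧
        ((iidSamples n (G ⇑θ1)).prod
          ((iidSamples n (G ⇑θ2)).prod (iidSamples m (G ⇑θ2))))
            {x | ψ x = false} ≤ 1/4)

/-- The body `Γ = {θ ∈ ℓ²(ℕ) : Σ_{i ≥ 1} i·|θ_i| ≤ 1}` (coordinates indexed from `0`, so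
coordinate `i` carries weight `i + 1`). -/
noncomputable def counterBody : Set SeqL2 :=
  {θ : SeqL2 | (∑' i : ℕ, ENNReal.ofReal (((i : ℝ) + 1) * |θ i|)) ≤ 1}

open scoped NNReal

/-! ### Gaussian product measures -/

/-- A measure satisfying `IsGaussianSeq θ` is the infinite product of the coordinate laws. -/
lemma IsGaussianSeq.eq_infinitePi {θ : ℕ → ℝ} {ν : Measure (ℕ → ℝ)} (h : IsGaussianSeq θ ν) :
    ν = Measure.infinitePi (fun i => gaussianReal (θ i) 1) :=
  h.2.unique (Measure.isProjectiveLimit_infinitePi _)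

/-- The joint law of `n` samples from a product law on `ℝ^ℕ` is the curried product law
on `ℝ^(Fin n × ℕ)`. -/
lemma iidSamples_infinitePi (n : ℕ) (μ : ℕ → Measure ℝ) [∀ i, IsProbabilityMeasure (μ i)] :
    iidSamples n (Measure.infinitePi μ) =
      (Measure.infinitePi (fun p : Fin n × ℕ => μ p.2)).map (MeasurableEquiv.curry (Fin n) ℕ ℝ) := by
  rw [iidSamples, Measure.infinitePi_map_curry (fun (_ : Fin n) i => μ i)]
  exact (Measure.infinitePi_eq_pi _).symm

lemma lintegral_prod_infinitePi {ι : Type*} {μ : ι → Measure ℝ} [∀ i, IsProbabilityMeasure (μ i)]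
    (s : Finset ι) {f : ι → ℝ → ℝ≥0∞} (hf : ∀ i, Measurable (f i)) :
    ∫⁻ x, ∏ i ∈ s, f i (x i) ∂Measure.infinitePi μ = ∏ i ∈ s, ∫⁻ y, f i y ∂μ i := by
  rw [lintegral_prod_eq_prod_lintegral_of_indepFun s (fun i (x : ι → ℝ) => f i (x i))
    (iIndepFun_infinitePi hf) (fun i => (hf i).comp (measurable_pi_apply i))]
  refine Finset.prod_congr rfl fun i _ => ?_
  rw [← Measure.infinitePi_map_eval μ i, lintegral_map (hf i) (measurable_pi_apply i)]

/-- The likelihood ratio of `N(m, 1)` with respect to `N(0, 1)`. -/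
noncomputable def gaussianLR (m y : ℝ) : ℝ := exp (m * y - m ^ 2 / 2)

lemma gaussianLR_nonneg (m y : ℝ) : 0 ≤ gaussianLR m y := (exp_pos _).le

@[simp] lemma gaussianLR_zero (y : ℝ) : gaussianLR 0 y = 1 := by simp [gaussianLR]

@[fun_prop] lemma measurable_gaussianLR (m : ℝ) : Measurable (gaussianLR m) := by
  unfold gaussianLR; fun_prop

lemma gaussianReal_eq_withDensity_gaussianLR (m : ℝ) :
    gaussianReal m 1 =
      (gaussianReal 0 1).withDensity (fun y => ENNReal.ofReal (gaussianLR m y)) := by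
  rw [gaussianReal_of_var_ne_zero m one_ne_zero, gaussianReal_of_var_ne_zero 0 one_ne_zero,
    ← withDensity_mul _ (measurable_gaussianPDF 0 1) (by fun_prop)]
  congr 1
  ext y
  simp only [Pi.mul_apply, gaussianPDF, ← ENNReal.ofReal_mul (gaussianPDFReal_nonneg 0 1 y)]
  congr 1
  simp only [gaussianPDFReal, gaussianLR, mul_assoc, ← exp_add]
  congr 2
  simp
  ring

lemma lintegral_gaussianLR_mul (m m' : ℝ) :
    ∫⁻ y, ENNReal.ofReal (gaussianLR m y * gaussianLR m' y) ∂gaussianReal 0 1 =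
      ENNReal.ofReal (exp (m * m')) := by
  have h (y : ℝ) : gaussianLR m y * gaussianLR m' y =
      exp (-(m ^ 2 + m' ^ 2) / 2) * exp ((m + m') * y) := by
    simp only [gaussianLR, ← exp_add]; congr 1; ring
  simp only [h]
  rw [← ofReal_integral_eq_lintegral_ofReal
    ((integrable_exp_mul_gaussianReal _).const_mul _) (by filter_upwards with y; positivity),
    integral_const_mul]
  have h2 := congrFun (mgf_id_gaussianReal (μ := 0) (v := 1)) (m + m')
  simp only [mgf, id] at h2
  rw [h2, ← exp_add]
  congr 2
  simp
  ring

/-- The likelihood ratio, on the coordinates in `s`, of the standard Gaussian product measure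
shifted by `μ`. -/
noncomputable def productLR {ι : Type*} (s : Finset ι) (μ : ι → ℝ) (x : ι → ℝ) : ℝ :=
  ∏ i ∈ s, gaussianLR (μ i) (x i)

section productLR

variable {ι : Type*} (s : Finset ι) (μ ν : ι → ℝ)

lemma productLR_nonneg (x : ι → ℝ) : 0 ≤ productLR s μ x :=
  Finset.prod_nonneg fun _ _ => gaussianLR_nonneg _ _

@[simp] lemma productLR_zero (x : ι → ℝ) : productLR s 0 x = 1 := by simp [productLR]

@[fun_prop] lemma measurable_productLR : Measurable (productLR s μ) := by
  unfold productLR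
  exact Finset.measurable_fun_prod _ fun i _ =>
    (measurable_gaussianLR _).comp (measurable_pi_apply i)

lemma lintegral_productLR_mul :
    ∫⁻ x, ENNReal.ofReal (productLR s μ x * productLR s ν x)
        ∂Measure.infinitePi (fun _ : ι => gaussianReal 0 1) =
      ENNReal.ofReal (exp (∑ i ∈ s, μ i * ν i)) := by
  have h (x : ι → ℝ) : ENNReal.ofReal (productLR s μ x * productLR s ν x) =
      ∏ i ∈ s, ENNReal.ofReal (gaussianLR (μ i) (x i) * gaussianLR (ν i) (x i)) := by
    rw [productLR, productLR, ← Finset.prod_mul_distrib, ENNReal.ofReal_prod_of_nonneg]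
    exact fun i _ => mul_nonneg (gaussianLR_nonneg _ _) (gaussianLR_nonneg _ _)
  simp only [h]
  rw [lintegral_prod_infinitePi s
    (f := fun i y => ENNReal.ofReal (gaussianLR (μ i) y * gaussianLR (ν i) y))
    (fun i => by fun_prop)]
  simp only [lintegral_gaussianLR_mul]
  rw [← ENNReal.ofReal_prod_of_nonneg (fun _ _ => (exp_pos _).le), exp_sum]

lemma integrable_productLR_mul :
    Integrable (fun x => productLR s μ x * productLR s ν x)
      (Measure.infinitePi (fun _ : ι => gaussianReal 0 1)) := by
  refine ⟨by fun_prop, ?_⟩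
  rw [hasFiniteIntegral_iff_ofReal (.of_forall fun x =>
    mul_nonneg (productLR_nonneg _ _ _) (productLR_nonneg _ _ _)), lintegral_productLR_mul]
  exact ENNReal.ofReal_lt_top

lemma integral_productLR_mul :
    ∫ x, productLR s μ x * productLR s ν x
        ∂Measure.infinitePi (fun _ : ι => gaussianReal 0 1) = exp (∑ i ∈ s, μ i * ν i) := by
  rw [integral_eq_lintegral_of_nonneg_ae (.of_forall fun x =>
    mul_nonneg (productLR_nonneg _ _ _) (productLR_nonneg _ _ _)) (by fun_prop),
    lintegral_productLR_mul, ENNReal.toReal_ofReal (exp_pos _).le]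

lemma integrable_productLR :
    Integrable (productLR s μ) (Measure.infinitePi (fun _ : ι => gaussianReal 0 1)) := by
  simpa using integrable_productLR_mul s μ 0

lemma integral_productLR :
    ∫ x, productLR s μ x ∂Measure.infinitePi (fun _ : ι => gaussianReal 0 1) = 1 := by
  simpa using integral_productLR_mul s μ 0

variable {s μ}

lemma infinitePi_gaussianReal_eq_withDensity (h : ∀ i ∉ s, μ i = 0) :
    Measure.infinitePi (fun i => gaussianReal (μ i) 1) =
      (Measure.infinitePi (fun _ : ι => gaussianReal 0 1)).withDensity
        (fun x => ENNReal.ofReal (productLR s μ x)) := by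
  classical
  symm
  apply Measure.eq_infinitePi
  intro u t ht
  have hu : MeasurableSet ((u : Set ι).pi t) := .pi u.countable_toSet fun i _ => ht i
  rw [withDensity_apply _ hu, ← lintegral_indicator hu]
  have key (x : ι → ℝ) :
      ((u : Set ι).pi t).indicator (fun x => ENNReal.ofReal (productLR s μ x)) x =
        ∏ i ∈ s ∪ u, (if i ∈ u then t i else Set.univ).indicator
          (fun y => ENNReal.ofReal (gaussianLR (μ i) y)) (x i) := by
    by_cases hx : x ∈ (u : Set ι).pi t
    · rw [Set.indicator_of_mem hx, productLR,
        ENNReal.ofReal_prod_of_nonneg fun _ _ => gaussianLR_nonneg _ _,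
        Finset.prod_subset Finset.subset_union_left (fun i _ hi => by simp [h i hi])]
      refine Finset.prod_congr rfl fun i _ => ?_
      rw [Set.indicator_of_mem]
      split_ifs with hi
      · exact hx i hi
      · trivial
    · rw [Set.indicator_of_notMem hx]
      simp only [Set.mem_pi, not_forall] at hx
      obtain ⟨i, hi, hxi⟩ := hx
      refine (Finset.prod_eq_zero (Finset.mem_union_right s hi) ?_).symm
      rw [Set.indicator_of_notMem]
      simpa [Finset.mem_coe.1 hi] using hxi
  have ht' (i : ι) : MeasurableSet (if i ∈ u then t i else Set.univ) := by
    split_ifs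
    · exact ht i
    · exact .univ
  simp only [key]
  rw [lintegral_prod_infinitePi (s ∪ u) (f := fun i =>
    (if i ∈ u then t i else Set.univ).indicator fun y => ENNReal.ofReal (gaussianLR (μ i) y))
    (fun i => Measurable.indicator (by fun_prop) (ht' i))]
  have hi (i : ι) : ∫⁻ y, (if i ∈ u then t i else Set.univ).indicator
      (fun y => ENNReal.ofReal (gaussianLR (μ i) y)) y ∂gaussianReal 0 1 =
      gaussianReal (μ i) 1 (if i ∈ u then t i else Set.univ) := by
    rw [lintegral_indicator (ht' i), ← withDensity_apply _ (ht' i),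
      ← gaussianReal_eq_withDensity_gaussianLR]
  simp only [hi]
  rw [← Finset.prod_subset Finset.subset_union_right (fun i _ hi => by simp [hi])]
  exact Finset.prod_congr rfl fun i hi => by simp [hi]

end productLR

/-! ### The second-moment method -/

/-- **Second-moment method**. If a finite mixture of probability densities `D f` with respect to
`P` can be tested against `P` with both errors at most `1/4`, then its `χ²`-divergence from `P`
is at least `1/4`. -/
lemma one_fourth_le_chiSq_of_test {Ω F : Type*} [MeasurableSpace Ω] [Fintype F] [Nonempty F]
    {P : Measure Ω} [IsProbabilityMeasure P] {D : F → Ω → ℝ} {K : F → F → ℝ}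
    (hint : ∀ f, Integrable (D f) P) (hone : ∀ f, ∫ x, D f x ∂P = 1)
    (hint2 : ∀ f g, Integrable (fun x => D f x * D g x) P)
    (hK : ∀ f g, ∫ x, D f x * D g x ∂P = K f g)
    {A : Set Ω} (hnull : 3 / 4 ≤ P.real A)
    (halt : ∀ f, ∫ x in A, D f x ∂P ≤ 1 / 4) :
    5 / 4 * (Fintype.card F : ℝ) ^ 2 ≤ ∑ f, ∑ g, K f g := by
  set N : ℝ := (Fintype.card F : ℝ) with hN
  have hNpos : 0 < N := by rw [hN]; exact_mod_cast Fintype.card_pos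
  set L : Ω → ℝ := fun x => N⁻¹ * ∑ f, D f x with hL
  have hLint : Integrable L P := (integrable_finsetSum _ fun f _ => hint f).const_mul _
  have hLone : ∫ x, L x ∂P = 1 := by
    rw [hL, integral_const_mul, integral_finsetSum _ fun f _ => hint f]
    simp [hone, ← hN, hNpos.ne']
  have hLsq (x : Ω) : L x ^ 2 = (N ^ 2)⁻¹ * ∑ f, ∑ g, D f x * D g x := by
    simp only [hL, mul_pow, inv_pow, sq (∑ f, D f x), Finset.sum_mul_sum]
  have hLsq_int : Integrable (fun x => L x ^ 2) P := by
    simp only [hLsq]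
    exact (integrable_finsetSum _ fun f _ => integrable_finsetSum _ fun g _ =>
      hint2 f g).const_mul _
  have hLsq_val : ∫ x, L x ^ 2 ∂P = (N ^ 2)⁻¹ * ∑ f, ∑ g, K f g := by
    simp only [hLsq]
    rw [integral_const_mul, integral_finsetSum _ fun f _ =>
      integrable_finsetSum _ fun g _ => hint2 f g]
    congr 1
    refine Finset.sum_congr rfl fun f _ => ?_
    rw [integral_finsetSum _ fun g _ => hint2 f g]
    exact Finset.sum_congr rfl fun g _ => hK f g
  have hLA : ∫ x in A, L x ∂P ≤ 1 / 4 := by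
    rw [hL, integral_const_mul, integral_finsetSum _ fun f _ => (hint f).integrableOn,
      inv_mul_le_iff₀ hNpos]
    calc ∑ f, ∫ x in A, D f x ∂P ≤ ∑ _f : F, (1 / 4 : ℝ) := Finset.sum_le_sum fun f _ => halt f
      _ = N * (1 / 4) := by simp [← hN]
  have hlin_int : Integrable (fun x => (-2) * L x + L x ^ 2) P := (hLint.const_mul _).add hLsq_int
  have hexpand : (fun x => 1 / 4 + (1 - L x) ^ 2) = fun x => 5 / 4 + ((-2) * L x + L x ^ 2) := by
    ext x; ring
  have hsq_int : Integrable (fun x => 1 / 4 + (1 - L x) ^ 2) P := by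
    rw [hexpand]
    exact (integrable_const _).add hlin_int
  have hsq_val : ∫ x, (1 / 4 + (1 - L x) ^ 2) ∂P = (N ^ 2)⁻¹ * ∑ f, ∑ g, K f g - 3 / 4 := by
    rw [hexpand, integral_add (integrable_const _) hlin_int,
      integral_add (hLint.const_mul _) hLsq_int, integral_const_mul, hLone, hLsq_val]
    simp
    ring
  have hlow : 1 / 2 ≤ ∫ x in A, (1 - L x) ∂P := by
    rw [integral_sub (integrable_const _) hLint.integrableOn]
    simp
    linarith
  have hup : ∫ x in A, (1 - L x) ∂P ≤ ∫ x, (1 / 4 + (1 - L x) ^ 2) ∂P := by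
    calc ∫ x in A, (1 - L x) ∂P ≤ ∫ x in A, (1 / 4 + (1 - L x) ^ 2) ∂P := by
          refine integral_mono ((integrable_const _).sub hLint.integrableOn) hsq_int.integrableOn
            fun x => ?_
          have := sq_nonneg (1 - L x - 1 / 2)
          simp only
          nlinarith
      _ ≤ _ := setIntegral_le_integral hsq_int (.of_forall fun x => by positivity)
  have hfin : 5 / 4 ≤ (N ^ 2)⁻¹ * ∑ f, ∑ g, K f g := by linarith
  rwa [inv_mul_eq_div, le_div_iff₀ (by positivity)] at hfin

/-! ### Lower bound -/

/-- There is a test of `θ = 0` against `θ ∈ Γ, ‖θ‖ ≥ ε` from `n` samples with both errors at most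
`1/4`. -/
def GofFeasible (G : (ℕ → ℝ) → Measure (ℕ → ℝ)) (Γ : Set SeqL2) (ε : ℝ) (n : ℕ) : Prop :=
  ∃ ψ : (Fin n → (ℕ → ℝ)) → Bool, Measurable ψ ∧
    (iidSamples n (G 0)) {x | ψ x = true} ≤ 1/4 ∧
    ∀ θ ∈ Γ, ε ≤ ‖θ‖ → (iidSamples n (G ⇑θ)) {x | ψ x = false} ≤ 1/4

/-- The law of `n` samples of `N(θ, I_∞)`, as a measure on `ℝ^(Fin n × ℕ)`. -/
noncomputable abbrev sampleLaw (n : ℕ) (θ : ℕ → ℝ) : Measure (Fin n × ℕ → ℝ) :=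
  Measure.infinitePi fun p => gaussianReal (θ p.2) 1

lemma IsGaussianSeq.iidSamples_apply {θ : ℕ → ℝ} {ν : Measure (ℕ → ℝ)} (h : IsGaussianSeq θ ν)
    (n : ℕ) (A : Set (Fin n → ℕ → ℝ)) :
    iidSamples n ν A = sampleLaw n θ (MeasurableEquiv.curry (Fin n) ℕ ℝ ⁻¹' A) := by
  rw [h.eq_infinitePi, iidSamples_infinitePi, MeasurableEquiv.map_apply]

lemma SeqL2.summable_sq (θ : SeqL2) : Summable fun i => θ i ^ 2 := by
  simpa using (lp.memℓp θ).summable (by norm_num)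

lemma SeqL2.norm_sq_eq_tsum (θ : SeqL2) : ‖θ‖ ^ 2 = ∑' i, θ i ^ 2 := by
  simpa using lp.norm_rpow_eq_tsum (p := 2) (by norm_num) θ

/-- The sequence which has, in each of `s` consecutive blocks of `m` coordinates, a single nonzero
coordinate, equal to `τ` and located at the position prescribed by `f`. -/
noncomputable def blockSpike {s m : ℕ} (τ : ℝ) (f : Fin s → Fin m) (i : ℕ) : ℝ :=
  if h : i < s * m then
    if f (finProdFinEquiv.symm ⟨i, h⟩).1 = (finProdFinEquiv.symm ⟨i, h⟩).2 then τ else 0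
  else 0

section blockSpike

variable {s m : ℕ} (τ : ℝ) (f g : Fin s → Fin m)

lemma blockSpike_finProdFinEquiv (j : Fin s) (a : Fin m) :
    blockSpike τ f (finProdFinEquiv (j, a)) = if f j = a then τ else 0 := by
  rw [blockSpike, dif_pos (finProdFinEquiv (j, a)).2]
  simp only [Fin.eta, Equiv.symm_apply_apply]

lemma blockSpike_of_le {i : ℕ} (h : s * m ≤ i) : blockSpike τ f i = 0 :=
  dif_neg (not_lt.2 h)

lemma sum_range_mul_eq_sum_blocks (φ : ℕ → ℝ) :
    ∑ i ∈ Finset.range (s * m), φ i = ∑ j : Fin s, ∑ a : Fin m, φ (finProdFinEquiv (j, a)) := by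
  rw [Finset.sum_range, ← finProdFinEquiv.sum_comp, Fintype.sum_prod_type]

lemma sum_blockSpike_mul :
    ∑ i ∈ Finset.range (s * m), blockSpike τ f i * blockSpike τ g i =
      ∑ j, if f j = g j then τ ^ 2 else 0 := by
  rw [sum_range_mul_eq_sum_blocks]
  refine Finset.sum_congr rfl fun j _ => ?_
  simp only [blockSpike_finProdFinEquiv, ite_mul, zero_mul]
  rw [Finset.sum_ite_eq]
  simp [sq, eq_comm]

lemma tsum_blockSpike_sq : ∑' i, blockSpike τ f i ^ 2 = s * τ ^ 2 := by
  rw [tsum_eq_sum (s := Finset.range (s * m)) fun i hi => by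
    rw [blockSpike_of_le τ f (by simpa using hi)]; simp]
  simp only [sq]
  rw [sum_blockSpike_mul]
  simp [sq]

lemma memℓp_blockSpike : Memℓp (blockSpike τ f) 2 := by
  refine memℓp_gen (summable_of_ne_finset_zero (s := Finset.range (s * m)) fun i hi => ?_)
  rw [blockSpike_of_le τ f (by simpa using hi)]
  simp

lemma blockSpike_mem_counterBody (hτ : 0 ≤ τ) (h : τ * s * (s * m) ≤ 1) :
    (⟨blockSpike τ f, memℓp_blockSpike τ f⟩ : SeqL2) ∈ counterBody := by
  change ∑' i : ℕ, ENNReal.ofReal (((i : ℝ) + 1) * |blockSpike τ f i|) ≤ 1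
  rw [tsum_eq_sum (s := Finset.range (s * m)) fun i hi => by
    rw [blockSpike_of_le τ f (by simpa using hi)]; simp,
    ← ENNReal.ofReal_sum_of_nonneg fun i _ => by positivity]
  refine ENNReal.ofReal_le_one.2 (le_trans ?_ h)
  calc ∑ i ∈ Finset.range (s * m), ((i : ℝ) + 1) * |blockSpike τ f i|
      ≤ ∑ i ∈ Finset.range (s * m), (s * m : ℝ) * |blockSpike τ f i| := by
        refine Finset.sum_le_sum fun i hi => mul_le_mul_of_nonneg_right ?_ (abs_nonneg _)
        exact_mod_cast Finset.mem_range.1 hi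
    _ = τ * s * (s * m) := by
        rw [← Finset.mul_sum, sum_range_mul_eq_sum_blocks (fun i => |blockSpike τ f i|)]
        simp only [blockSpike_finProdFinEquiv, apply_ite abs, abs_zero, abs_of_nonneg hτ]
        simp
        ring

/-- The second moment of the mixture likelihood ratio for the uniform choice of spike positions. -/
lemma sum_exp_sum_ite_eq (c : ℝ) :
    ∑ f : Fin s → Fin m, ∑ g : Fin s → Fin m, exp (∑ j, if f j = g j then c else 0) =
      (m : ℝ) ^ s * (m - 1 + exp c) ^ s := by
  have h1 (a : Fin m) : ∑ b : Fin m, exp (if a = b then c else 0) = m - 1 + exp c := by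
    have h2 (b : Fin m) : exp (if a = b then c else 0) = 1 + if a = b then exp c - 1 else 0 := by
      split_ifs <;> simp
    simp only [h2, Finset.sum_add_distrib, Finset.sum_ite_eq]
    simp
    ring
  have h (f : Fin s → Fin m) :
      ∑ g : Fin s → Fin m, exp (∑ j, if f j = g j then c else 0) = (m - 1 + exp c) ^ s := by
    simp only [exp_sum]
    rw [← Fintype.prod_sum fun j b => exp (if f j = b then c else 0)]
    simp [h1]
  simp [h]

end blockSpike

lemma not_gofFeasible_counterBody {G : (ℕ → ℝ) → Measure (ℕ → ℝ)}
    (hG : ∀ θ : ℕ → ℝ, IsGaussianSeq θ (G θ)) {ε τ : ℝ} {s m n : ℕ} (hτ : 0 ≤ τ) (hm : 0 < m)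
    (hε : ε ^ 2 ≤ s * τ ^ 2) (hbody : τ * s * (s * m) ≤ 1)
    (hn : s * (exp (n * τ ^ 2) - 1) ≤ m / 10) : ¬ GofFeasible G counterBody ε n := by
  rintro ⟨ψ, hψ, hnull, halt⟩
  have hm' : (0 : ℝ) < m := by exact_mod_cast hm
  have : Nonempty (Fin m) := ⟨⟨0, hm⟩⟩
  set P := Measure.infinitePi fun _ : Fin n × ℕ => gaussianReal 0 1
  set S : Finset (Fin n × ℕ) := Finset.univ ×ˢ Finset.range (s * m)
  set A : Set (Fin n × ℕ → ℝ) := MeasurableEquiv.curry (Fin n) ℕ ℝ ⁻¹' {x | ψ x = false}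
  have hA : MeasurableSet A :=
    (MeasurableEquiv.measurable _) (hψ (measurableSet_singleton false))
  let μ : (Fin s → Fin m) → Fin n × ℕ → ℝ := fun f p => blockSpike τ f p.2
  have key := one_fourth_le_chiSq_of_test (P := P) (D := fun f => productLR S (μ f))
    (K := fun f g => exp (∑ p ∈ S, μ f p * μ g p)) (A := A)
    (fun f => integrable_productLR S _) (fun f => integral_productLR S _)
    (fun f g => integrable_productLR_mul S _ _) (fun f g => integral_productLR_mul S _ _)
    ?_ ?_
  · have hsum (f g : Fin s → Fin m) :
        ∑ p ∈ S, μ f p * μ g p = ∑ j, if f j = g j then n * τ ^ 2 else 0 := by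
      rw [Finset.sum_product]
      simp only [μ, sum_blockSpike_mul]
      simp [Finset.mul_sum]
    simp only [hsum, sum_exp_sum_ite_eq] at key
    simp only [Fintype.card_fun, Fintype.card_fin, Nat.cast_pow] at key
    have h1 : (m : ℝ) - 1 + exp (n * τ ^ 2) ≤ m * exp ((exp (n * τ ^ 2) - 1) / m) := by
      have := add_one_le_exp ((exp (n * τ ^ 2) - 1) / m)
      calc (m : ℝ) - 1 + exp (n * τ ^ 2) = m * ((exp (n * τ ^ 2) - 1) / m + 1) := by
            field_simp; ring
        _ ≤ _ := by gcongr
    have h0 : 1 ≤ exp (n * τ ^ 2) := one_le_exp (by positivity)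
    have h2 : ((m : ℝ) - 1 + exp (n * τ ^ 2)) ^ s ≤ m ^ s * exp (1 / 10) := by
      calc ((m : ℝ) - 1 + exp (n * τ ^ 2)) ^ s
          ≤ (m * exp ((exp (n * τ ^ 2) - 1) / m)) ^ s := by
            refine pow_le_pow_left₀ ?_ h1 s
            linarith
        _ = m ^ s * exp (s * (exp (n * τ ^ 2) - 1) / m) := by
            rw [mul_pow, ← exp_nat_mul]; congr 2; ring
        _ ≤ m ^ s * exp (1 / 10) := by
            refine mul_le_mul_of_nonneg_left (exp_le_exp.2 ?_) (by positivity)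
            rw [div_le_iff₀ hm']
            linarith
    have h3 : exp (1 / 10) < 5 / 4 := by
      have := exp_bound_div_one_sub_of_interval (x := 1 / 10) (by norm_num) (by norm_num)
      norm_num at this ⊢
      linarith
    have h4 : (0 : ℝ) < m ^ s := by positivity
    have h5 : (m : ℝ) ^ s * (m - 1 + exp (n * τ ^ 2)) ^ s ≤ m ^ s * (m ^ s * exp (1 / 10)) := by
      gcongr
    nlinarith [mul_pos h4 h4]
  · rw [(hG 0).iidSamples_apply] at hnull
    have hc : Aᶜ = MeasurableEquiv.curry (Fin n) ℕ ℝ ⁻¹' {x | ψ x = true} := by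
      ext x; simp [A]
    rw [← hc] at hnull
    have h := probReal_add_probReal_compl (μ := P) hA
    have h2 : P.real Aᶜ ≤ 1 / 4 := by
      refine ENNReal.toReal_le_of_le_ofReal (by norm_num) (hnull.trans_eq ?_)
      rw [ENNReal.ofReal_div_of_pos (by norm_num)]; simp
    linarith
  · intro f
    have h := halt ⟨_, memℓp_blockSpike τ f⟩ (blockSpike_mem_counterBody τ f hτ hbody) ?_
    · rw [(hG _).iidSamples_apply] at h
      change sampleLaw n (blockSpike τ f) A ≤ 1 / 4 at h
      rw [sampleLaw, infinitePi_gaussianReal_eq_withDensity (s := S) (μ := μ f)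
        (fun p hp => blockSpike_of_le τ f (by simpa [S] using hp)), withDensity_apply _ hA] at h
      rw [integral_eq_lintegral_of_nonneg_ae (.of_forall fun x => productLR_nonneg _ _ _)
        (by fun_prop)]
      refine ENNReal.toReal_le_of_le_ofReal (by norm_num) (h.trans_eq ?_)
      rw [ENNReal.ofReal_div_of_pos (by norm_num)]; simp
    · refine le_of_sq_le_sq ?_ (norm_nonneg _)
      rw [SeqL2.norm_sq_eq_tsum]
      exact hε.trans_eq (tsum_blockSpike_sq τ f).symm

/-! ### Upper bound -/

section gaussianReal

variable (m : ℝ) (v : ℝ≥0)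

lemma integral_pow_gaussianReal (k : ℕ) :
    ∫ x, x ^ k ∂gaussianReal m v =
      iteratedDeriv k (fun t => exp (m * t + v * t ^ 2 / 2)) 0 := by
  rw [← mgf_id_gaussianReal, iteratedDeriv_mgf_zero (by simp [integrableExpSet_id_gaussianReal])]
  simp

lemma deriv_mul_exp_quadratic {p p' : ℝ → ℝ} (hp : ∀ t, HasDerivAt p (p' t) t) :
    deriv (fun t => p t * exp (m * t + v * t ^ 2 / 2)) =
      fun t => (p' t + p t * (m + v * t)) * exp (m * t + v * t ^ 2 / 2) := by
  ext t
  have h : HasDerivAt (fun t => m * t + v * t ^ 2 / 2) (m + v * t) t := by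
    have := ((hasDerivAt_id t).const_mul m).add
      ((((hasDerivAt_id t).pow 2).const_mul (v : ℝ)).div_const 2)
    refine this.congr_deriv ?_
    simp; ring
  exact ((hp t).mul h.exp).deriv.trans (by ring)

lemma iteratedDeriv_two_exp_quadratic :
    iteratedDeriv 2 (fun t => exp (m * t + v * t ^ 2 / 2)) =
      fun t => (v + (m + v * t) ^ 2) * exp (m * t + v * t ^ 2 / 2) := by
  have h1 := deriv_mul_exp_quadratic m v (p := fun _ => 1) (p' := fun _ => 0)
    fun t => hasDerivAt_const _ _
  have h2 := deriv_mul_exp_quadratic m v (p := fun t => m + v * t) (p' := fun _ => v)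
    fun t => by simpa using ((hasDerivAt_id t).const_mul (v : ℝ)).const_add m
  simp only [one_mul, zero_add] at h1
  rw [iteratedDeriv_succ, iteratedDeriv_one, h1, h2]
  ext t; ring

lemma integral_sq_gaussianReal : ∫ x, x ^ 2 ∂gaussianReal m v = m ^ 2 + v := by
  rw [integral_pow_gaussianReal, iteratedDeriv_two_exp_quadratic]
  simp; ring

lemma integral_pow_four_gaussianReal :
    ∫ x, x ^ 4 ∂gaussianReal m v = m ^ 4 + 6 * m ^ 2 * v + 3 * v ^ 2 := by
  have hlin (t : ℝ) : HasDerivAt (fun t => m + v * t) (v : ℝ) t := by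
    simpa using ((hasDerivAt_id t).const_mul (v : ℝ)).const_add m
  have h3 := deriv_mul_exp_quadratic m v (p := fun t => v + (m + v * t) ^ 2)
    (p' := fun t => 2 * (m + v * t) * v)
    fun t => by simpa using ((hlin t).pow 2).const_add (v : ℝ)
  have h4 := deriv_mul_exp_quadratic m v
    (p := fun t => 2 * (m + v * t) * v + (v + (m + v * t) ^ 2) * (m + v * t))
    (p' := fun t => 2 * v * v + (2 * (m + v * t) * v * (m + v * t) + (v + (m + v * t) ^ 2) * v))
    fun t => by
      have h : HasDerivAt (fun t => v + (m + v * t) ^ 2) (2 * (m + v * t) * v) t := by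
        simpa using ((hlin t).pow 2).const_add (v : ℝ)
      exact (((hlin t).const_mul 2).mul_const (v : ℝ)).add (h.mul (hlin t))
  rw [integral_pow_gaussianReal, iteratedDeriv_succ, iteratedDeriv_succ,
    iteratedDeriv_two_exp_quadratic, h3, h4]
  simp; ring

lemma memLp_sq_gaussianReal : MemLp (fun x : ℝ => x ^ 2) 2 (gaussianReal m v) := by
  have h := memLp_id_gaussianReal' (μ := m) (v := v) 4 (by norm_num)
  have h2 := (integrable_norm_rpow_iff h.1 (by norm_num) (by norm_num)).2 h
  rw [memLp_two_iff_integrable_sq (by fun_prop)]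
  refine h2.congr (.of_forall fun x => ?_)
  simp only [id, ENNReal.toReal_ofNat]
  rw [show (4 : ℝ) = ((4 : ℕ) : ℝ) by norm_num, rpow_natCast, norm_eq_abs, ← pow_mul,
    Even.pow_abs (by decide)]

lemma variance_sq_gaussianReal :
    Var[fun x => x ^ 2; gaussianReal m v] = 2 * v ^ 2 + 4 * m ^ 2 * v := by
  rw [variance_eq_sub (memLp_sq_gaussianReal m v)]
  simp only [Pi.pow_apply, ← pow_mul]
  rw [integral_pow_four_gaussianReal, integral_sq_gaussianReal]
  ring

lemma gaussianReal_le_abs_sub_le (hv : v ≠ 0) {a : ℝ} (ha : 0 ≤ a) :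
    gaussianReal m v {x | a ≤ |x - m|} ≤ ENNReal.ofReal (2 * exp (-(a ^ 2 / (2 * v)))) := by
  have hv' : (0 : ℝ) < v := by exact_mod_cast pos_iff_ne_zero.2 hv
  have hup := measure_ge_le_exp_mul_mgf (μ := gaussianReal m v) (X := id) (t := a / v) (m + a)
    (by positivity) (integrable_exp_mul_gaussianReal _)
  have hlo := measure_le_le_exp_mul_mgf (μ := gaussianReal m v) (X := id) (t := -(a / v)) (m - a)
    (by have : 0 ≤ a / v := by positivity
        linarith) (integrable_exp_mul_gaussianReal _)
  rw [mgf_id_gaussianReal, ← exp_add] at hup hlo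
  have e1 : -(a / v) * (m + a) + (m * (a / v) + v * (a / v) ^ 2 / 2) = -(a ^ 2 / (2 * v)) := by
    field_simp; ring
  have e2 : -(-(a / v)) * (m - a) + (m * (-(a / v)) + v * (-(a / v)) ^ 2 / 2) =
      -(a ^ 2 / (2 * v)) := by
    field_simp; ring
  rw [e1] at hup
  rw [e2] at hlo
  rw [← ofReal_measureReal]
  refine ENNReal.ofReal_le_ofReal ?_
  calc (gaussianReal m v).real {x | a ≤ |x - m|}
      ≤ (gaussianReal m v).real ({x | m + a ≤ id x} ∪ {x | id x ≤ m - a}) := by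
        refine measureReal_mono fun x hx => ?_
        rcases le_abs.1 (show a ≤ |x - m| from hx) with h | h
        · exact Or.inl (show m + a ≤ x by linarith)
        · exact Or.inr (show x ≤ m - a by linarith)
    _ ≤ _ := (measureReal_union_le _ _).trans (by linarith)

end gaussianReal

section coordSum

/-- The sum over the samples of the `i`-th coordinate. -/
def coordSum {n : ℕ} (i : ℕ) (x : Fin n × ℕ → ℝ) : ℝ := ∑ k, x (k, i)

@[fun_prop] lemma measurable_coordSum {n : ℕ} (i : ℕ) : Measurable (coordSum (n := n) i) := by
  unfold coordSum; fun_prop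

variable (n : ℕ) (θ : ℕ → ℝ)

lemma iIndepFun_eval_sampleLaw :
    iIndepFun (fun (p : Fin n × ℕ) (x : Fin n × ℕ → ℝ) => x p) (sampleLaw n θ) :=
  iIndepFun_infinitePi (X := fun _ => id) fun _ => measurable_id

lemma map_coordSum (i : ℕ) : (sampleLaw n θ).map (coordSum i) = gaussianReal (n * θ i) n := by
  classical
  have hind := (iIndepFun_eval_sampleLaw n θ).precomp
    (show Function.Injective fun k : Fin n => (k, i) from Prod.mk_left_injective i)
  have key (t : Finset (Fin n)) :
      (sampleLaw n θ).map (∑ k ∈ t, fun x : Fin n × ℕ → ℝ => x (k, i)) =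
        gaussianReal (t.card * θ i) t.card := by
    induction t using Finset.induction_on with
    | empty =>
      simp only [Finset.sum_empty, Finset.card_empty, Nat.cast_zero, zero_mul, gaussianReal_zero_var]
      rw [show (0 : (Fin n × ℕ → ℝ) → ℝ) = fun _ => 0 from rfl, Measure.map_const]
      simp
    | insert k t hk ih =>
      rw [Finset.sum_insert hk, Finset.card_insert_of_notMem hk]
      have h := gaussianReal_add_gaussianReal_of_indepFun
        (hind.indepFun_finsetSum_of_notMem (fun _ => by fun_prop) hk) ih
        (Measure.infinitePi_map_eval (fun p : Fin n × ℕ => gaussianReal (θ p.2) 1) (k, i))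
      rw [add_comm]
      convert h using 2 <;> push_cast <;> ring
  have := key Finset.univ
  rw [Finset.card_univ, Fintype.card_fin] at this
  rw [← this]
  congr 1
  ext x
  simp [coordSum]

lemma indepFun_coordSum {i j : ℕ} (hij : i ≠ j) :
    IndepFun (coordSum i) (coordSum j) (sampleLaw n θ) := by
  classical
  let S (l : ℕ) : Finset (Fin n × ℕ) := Finset.univ ×ˢ {l}
  have hS (l : ℕ) (k : Fin n) : (k, l) ∈ S l := by simp [S]
  have h := (iIndepFun_eval_sampleLaw n θ).indepFun_finset (S i) (S j)
    (Finset.disjoint_left.2 fun p hp hq => by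
      simp only [S, Finset.mem_product, Finset.mem_univ, Finset.mem_singleton, true_and] at hp hq
      exact hij (hp.symm.trans hq))
    fun _ => by fun_prop
  let f (l : ℕ) (y : S l → ℝ) : ℝ := ∑ k, y ⟨(k, l), hS l k⟩
  have hf (l : ℕ) : Measurable (f l) := by unfold f; fun_prop
  exact h.comp (hf i) (hf j)

lemma sampleLaw_coordSum_preimage (i : ℕ) {A : Set ℝ} (hA : MeasurableSet A) :
    sampleLaw n θ {x | coordSum i x ∈ A} = gaussianReal (n * θ i) n A := by
  rw [← map_coordSum, Measure.map_apply (measurable_coordSum i) hA]; rfl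

lemma memLp_coordSum_sq (i : ℕ) :
    MemLp (fun x => coordSum i x ^ 2) 2 (sampleLaw n θ) := by
  have h := memLp_sq_gaussianReal (n * θ i) n
  rw [← map_coordSum, memLp_map_measure_iff (by fun_prop) (by fun_prop)] at h
  exact h

lemma integral_coordSum_sq (i : ℕ) :
    ∫ x, coordSum i x ^ 2 ∂sampleLaw n θ = (n * θ i) ^ 2 + n := by
  have h := integral_sq_gaussianReal (n * θ i) n
  rw [← map_coordSum, integral_map (by fun_prop) (by fun_prop)] at h
  simpa using h

lemma variance_coordSum_sq (i : ℕ) :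
    Var[fun x => coordSum i x ^ 2; sampleLaw n θ] = 2 * n ^ 2 + 4 * (n * θ i) ^ 2 * n := by
  have h := variance_sq_gaussianReal (n * θ i) n
  rw [← map_coordSum, variance_map (by fun_prop) (by fun_prop)] at h
  simpa [Function.comp_def] using h

/-- The sum of squares of the first `d` coordinate sums. -/
def energy {n : ℕ} (d : ℕ) (x : Fin n × ℕ → ℝ) : ℝ := ∑ i ∈ Finset.range d, coordSum i x ^ 2

@[fun_prop] lemma measurable_energy {n : ℕ} (d : ℕ) : Measurable (energy (n := n) d) := by
  unfold energy; fun_prop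

lemma energy_eq (d : ℕ) : energy (n := n) d = ∑ i ∈ Finset.range d, fun x => coordSum i x ^ 2 := by
  ext x; simp [energy]

lemma memLp_energy (d : ℕ) : MemLp (energy d) 2 (sampleLaw n θ) := by
  rw [energy_eq]
  exact memLp_finsetSum' _ fun i _ => memLp_coordSum_sq n θ i

lemma integral_energy (d : ℕ) :
    ∫ x, energy d x ∂sampleLaw n θ = n ^ 2 * ∑ i ∈ Finset.range d, θ i ^ 2 + n * d := by
  unfold energy
  rw [integral_finsetSum _ fun i _ => (memLp_coordSum_sq n θ i).integrable (by norm_num)]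
  simp only [integral_coordSum_sq, Finset.sum_add_distrib, mul_pow, ← Finset.mul_sum]
  simp [mul_comm]

lemma variance_energy (d : ℕ) :
    Var[energy d; sampleLaw n θ] =
      2 * n ^ 2 * d + 4 * n ^ 3 * ∑ i ∈ Finset.range d, θ i ^ 2 := by
  rw [energy_eq, IndepFun.variance_sum (fun i _ => memLp_coordSum_sq n θ i) fun i _ j _ hij =>
    (indepFun_coordSum n θ hij).comp (measurable_id.pow_const 2) (measurable_id.pow_const 2)]
  simp only [variance_coordSum_sq, Finset.sum_add_distrib, Finset.mul_sum]
  congr 1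
  · simp; ring
  · exact Finset.sum_congr rfl fun i _ => by ring

end coordSum

section counterBody

variable {θ : SeqL2}

lemma sum_le_one_of_mem_counterBody (h : θ ∈ counterBody) (t : Finset ℕ) :
    ∑ i ∈ t, ((i : ℝ) + 1) * |θ i| ≤ 1 := by
  have h1 := (ENNReal.sum_le_tsum
    (f := fun i : ℕ => ENNReal.ofReal (((i : ℝ) + 1) * |θ i|)) t).trans h
  rw [← ENNReal.ofReal_sum_of_nonneg fun i _ => by positivity] at h1
  exact ENNReal.ofReal_le_one.1 h1

lemma abs_le_inv_of_mem_counterBody (h : θ ∈ counterBody) (i : ℕ) : |θ i| ≤ 1 / ((i : ℝ) + 1) := by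
  have := sum_le_one_of_mem_counterBody h {i}
  rw [Finset.sum_singleton] at this
  rw [le_div_iff₀ (by positivity)]
  linarith

lemma norm_sq_le_of_mem_counterBody (h : θ ∈ counterBody) {d : ℕ} {τ : ℝ} (hτ : 0 ≤ τ)
    (hθ : ∀ i, |θ i| ≤ τ) :
    ‖θ‖ ^ 2 ≤ ∑ i ∈ Finset.range d, θ i ^ 2 + τ / (d + 1) := by
  rw [SeqL2.norm_sq_eq_tsum]
  refine θ.summable_sq.tsum_le_of_sum_range_le fun K => ?_
  have hterm (i : ℕ) : θ i ^ 2 ≤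
      (if i < d then θ i ^ 2 else 0) + τ / (d + 1) * (((i : ℝ) + 1) * |θ i|) := by
    split_ifs with hi
    · have : 0 ≤ τ / (d + 1) * (((i : ℝ) + 1) * |θ i|) := by positivity
      linarith
    · have hdi : (d : ℝ) ≤ i := by exact_mod_cast not_lt.1 hi
      rw [zero_add, div_mul_eq_mul_div, le_div_iff₀ (by positivity), ← sq_abs]
      calc |θ i| ^ 2 * (d + 1) = |θ i| * ((d + 1) * |θ i|) := by ring
        _ ≤ τ * (((i : ℝ) + 1) * |θ i|) := by gcongr; exact hθ i
  calc ∑ i ∈ Finset.range K, θ i ^ 2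
      ≤ ∑ i ∈ Finset.range K,
          ((if i < d then θ i ^ 2 else 0) + τ / (d + 1) * (((i : ℝ) + 1) * |θ i|)) :=
        Finset.sum_le_sum fun i _ => hterm i
    _ = ∑ i ∈ Finset.range K with i < d, θ i ^ 2 +
          τ / (d + 1) * ∑ i ∈ Finset.range K, ((i : ℝ) + 1) * |θ i| := by
        rw [Finset.sum_add_distrib, Finset.sum_filter, Finset.mul_sum]
    _ ≤ ∑ i ∈ Finset.range d, θ i ^ 2 + τ / (d + 1) * 1 := by
        gcongr
        · intro i hi; simp_all
        · exact sum_le_one_of_mem_counterBody h _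
    _ = _ := by rw [mul_one]

end counterBody

lemma sampleLaw_le_abs_coordSum_sub {n : ℕ} (hn : 0 < n) (θ : ℕ → ℝ) (i : ℕ) {τ : ℝ}
    (hτ : 0 ≤ τ) :
    sampleLaw n θ {x | n * τ / 2 ≤ |coordSum i x - n * θ i|} ≤
      ENNReal.ofReal (2 * exp (-(n * τ ^ 2 / 8))) := by
  have hn' : (0 : ℝ) < n := by exact_mod_cast hn
  have hA : MeasurableSet {y : ℝ | n * τ / 2 ≤ |y - n * θ i|} :=
    measurableSet_le (by fun_prop) (by fun_prop)
  refine (sampleLaw_coordSum_preimage n θ i hA).le.trans ?_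
  refine (gaussianReal_le_abs_sub_le (n * θ i) n (by positivity) (by positivity)).trans_eq ?_
  congr 4
  simp only [NNReal.coe_natCast]
  field_simp
  norm_num

/-- The rejection region: either one of the first `N` coordinate sums is large, or the energy in
the first `d` coordinates is. -/
def rejectRegion (n N d : ℕ) (τ ε : ℝ) : Set (Fin n × ℕ → ℝ) :=
  {x | (∃ i < N, n * τ / 2 < |coordSum i x|) ∨ n * d + n ^ 2 * ε ^ 2 / 4 < energy d x}

lemma measurableSet_rejectRegion (n N d : ℕ) (τ ε : ℝ) :
    MeasurableSet (rejectRegion n N d τ ε) := by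
  have hE : MeasurableSet {x : Fin n × ℕ → ℝ | n * d + n ^ 2 * ε ^ 2 / 4 < energy d x} :=
    measurableSet_lt (by fun_prop) (by fun_prop)
  have hS : MeasurableSet {x : Fin n × ℕ → ℝ | ∃ i < N, n * τ / 2 < |coordSum i x|} := by
    have : {x : Fin n × ℕ → ℝ | ∃ i < N, n * τ / 2 < |coordSum i x|} =
        ⋃ i, ⋃ _ : i < N, {x | n * τ / 2 < |coordSum i x|} := by ext; simp
    rw [this]
    exact .iUnion fun i => .iUnion fun _ => measurableSet_lt (by fun_prop) (by fun_prop)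
  exact hS.union hE

section errors

variable {n N d : ℕ} {τ ε : ℝ}

lemma sampleLaw_zero_rejectRegion_le (hn : 0 < n) (hτ : 0 ≤ τ) (hε : 0 < ε) :
    sampleLaw n 0 (rejectRegion n N d τ ε) ≤
      ENNReal.ofReal (2 * N * exp (-(n * τ ^ 2 / 8)) + 32 * d / (n ^ 2 * ε ^ 4)) := by
  have hn' : (0 : ℝ) < n := by exact_mod_cast hn
  have hsub : rejectRegion n N d τ ε ⊆
      (⋃ i ∈ Finset.range N, {x | n * τ / 2 ≤ |coordSum i x - n * (0 : ℕ → ℝ) i|}) ∪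
        {x | n ^ 2 * ε ^ 2 / 4 ≤ |energy d x - ∫ x, energy d x ∂sampleLaw n 0|} := by
    rintro x (⟨i, hi, h⟩ | h)
    · refine Or.inl (Set.mem_iUnion₂.2 ⟨i, Finset.mem_range.2 hi, ?_⟩)
      simpa using h.le
    · right
      rw [Set.mem_ofPred_eq, integral_energy]
      refine le_trans ?_ (le_abs_self _)
      simp only [Pi.zero_apply, ne_eq, OfNat.ofNat_ne_zero, not_false_eq_true, zero_pow,
        Finset.sum_const_zero, mul_zero, zero_add]
      linarith
  refine (measure_mono hsub).trans ((measure_union_le _ _).trans ?_)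
  rw [ENNReal.ofReal_add (by positivity) (by positivity)]
  refine add_le_add ?_ ?_
  · refine (measure_biUnion_finset_le _ _).trans ?_
    refine (Finset.sum_le_sum fun i _ => sampleLaw_le_abs_coordSum_sub hn 0 i hτ).trans_eq ?_
    rw [Finset.sum_const, Finset.card_range, nsmul_eq_mul, ← ENNReal.ofReal_natCast,
      ← ENNReal.ofReal_mul (by positivity)]
    congr 1; ring
  · refine (meas_ge_le_variance_div_sq (memLp_energy n 0 d) (by positivity)).trans_eq ?_
    rw [variance_energy]
    congr 1
    simp only [Pi.zero_apply, ne_eq, OfNat.ofNat_ne_zero, not_false_eq_true, zero_pow,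
      Finset.sum_const_zero, mul_zero, add_zero]
    field_simp
    ring

lemma sampleLaw_compl_rejectRegion_le_of_spike (hn : 0 < n) (hτ : 0 ≤ τ) {θ : ℕ → ℝ} {i : ℕ}
    (hi : i < N) (hθ : τ ≤ |θ i|) :
    sampleLaw n θ (rejectRegion n N d τ ε)ᶜ ≤ ENNReal.ofReal (2 * exp (-(n * τ ^ 2 / 8))) := by
  refine (measure_mono fun x hx => ?_).trans (sampleLaw_le_abs_coordSum_sub hn θ i hτ)
  have h1 : |coordSum i x| ≤ n * τ / 2 := by
    by_contra! h
    exact hx (Or.inl ⟨i, hi, h⟩)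
  have h2 : n * τ ≤ |n * θ i| := by
    rw [abs_mul, Nat.abs_cast]; gcongr
  have h3 := abs_sub_abs_le_abs_sub (n * θ i) (coordSum i x)
  rw [abs_sub_comm] at h3
  exact show n * τ / 2 ≤ |coordSum i x - n * θ i| by linarith

lemma sampleLaw_compl_rejectRegion_le_of_energy (hn : 0 < n) (hε : 0 < ε) {θ : ℕ → ℝ}
    (hθ : ε ^ 2 / 2 ≤ ∑ i ∈ Finset.range d, θ i ^ 2) :
    sampleLaw n θ (rejectRegion n N d τ ε)ᶜ ≤
      ENNReal.ofReal (32 * d / (n ^ 2 * ε ^ 4) + 32 / (n * ε ^ 2)) := by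
  have hn' : (0 : ℝ) < n := by exact_mod_cast hn
  set M := ∑ i ∈ Finset.range d, θ i ^ 2 with hM
  have hM0 : 0 < M := lt_of_lt_of_le (by positivity) hθ
  have hsub : (rejectRegion n N d τ ε)ᶜ ⊆
      {x | n ^ 2 * M / 2 ≤ |energy d x - ∫ x, energy d x ∂sampleLaw n θ|} := by
    intro x hx
    have h1 : energy d x ≤ n * d + n ^ 2 * ε ^ 2 / 4 := by
      by_contra! h
      exact hx (Or.inr h)
    have h2 : (n : ℝ) ^ 2 * (ε ^ 2 / 2) ≤ n ^ 2 * M := by gcongr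
    rw [Set.mem_ofPred_eq, integral_energy, ← hM]
    refine le_trans ?_ (neg_le_abs _)
    linarith
  refine (measure_mono hsub).trans
    ((meas_ge_le_variance_div_sq (memLp_energy n θ d) (by positivity)).trans ?_)
  rw [variance_energy, ← hM]
  refine ENNReal.ofReal_le_ofReal ?_
  calc (2 * n ^ 2 * d + 4 * n ^ 3 * M) / (n ^ 2 * M / 2) ^ 2
      = 8 * d / (n ^ 2 * M ^ 2) + 16 / (n * M) := by field_simp; ring
    _ ≤ 8 * d / (n ^ 2 * (ε ^ 2 / 2) ^ 2) + 16 / (n * (ε ^ 2 / 2)) := by gcongr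
    _ = _ := by field_simp; ring

lemma gofFeasible_counterBody {G : (ℕ → ℝ) → Measure (ℕ → ℝ)} (hG : ∀ θ, IsGaussianSeq θ (G θ))
    (hn : 0 < n) (hN : 0 < N) (hτ : 0 < τ) (hε : 0 < ε) (hτN : 1 ≤ τ * (N + 1))
    (hτd : 2 * τ ≤ ε ^ 2 * (d + 1))
    (hnull : 2 * N * exp (-(n * τ ^ 2 / 8)) + 32 * d / (n ^ 2 * ε ^ 4) ≤ 1 / 4)
    (halt : 32 * d / (n ^ 2 * ε ^ 4) + 32 / (n * ε ^ 2) ≤ 1 / 4) :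
    GofFeasible G counterBody ε n := by
  classical
  have quarter {a : ℝ} (ha : a ≤ 1 / 4) : ENNReal.ofReal a ≤ 1 / 4 := by
    refine (ENNReal.ofReal_le_ofReal ha).trans_eq ?_
    rw [ENNReal.ofReal_div_of_pos (by norm_num)]; simp
  have hR := measurableSet_rejectRegion n N d τ ε
  set R := rejectRegion n N d τ ε with hRdef
  refine ⟨fun x => decide ((MeasurableEquiv.curry (Fin n) ℕ ℝ).symm x ∈ R), ?_, ?_, ?_⟩
  · refine measurable_to_bool ?_
    have : (fun x => decide ((MeasurableEquiv.curry (Fin n) ℕ ℝ).symm x ∈ R)) ⁻¹' {true} =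
        (MeasurableEquiv.curry (Fin n) ℕ ℝ).symm ⁻¹' R := by ext; simp
    rw [this]
    exact (MeasurableEquiv.measurable _) hR
  · rw [(hG 0).iidSamples_apply]
    refine (measure_mono fun x hx => ?_).trans
      ((sampleLaw_zero_rejectRegion_le (N := N) (d := d) hn hτ.le hε).trans (quarter hnull))
    simpa using hx
  · intro θ hθ hnorm
    rw [(hG θ).iidSamples_apply]
    refine (measure_mono (t := Rᶜ) fun x hx => ?_).trans ?_
    · simpa using hx
    by_cases hspike : ∃ i < N, τ ≤ |θ i|
    · obtain ⟨i, hi, h⟩ := hspike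
      refine (sampleLaw_compl_rejectRegion_le_of_spike hn hτ.le hi h).trans (quarter ?_)
      have h1 : (1 : ℝ) ≤ N := by exact_mod_cast hN
      have h2 : 0 ≤ 32 * d / (n ^ 2 * ε ^ 4) := by positivity
      have h3 : 2 * 1 * exp (-(n * τ ^ 2 / 8)) ≤ 2 * N * exp (-(n * τ ^ 2 / 8)) := by gcongr
      linarith
    · push Not at hspike
      refine (sampleLaw_compl_rejectRegion_le_of_energy hn hε ?_).trans (quarter halt)
      have hle (i : ℕ) : |θ i| ≤ τ := by
        rcases lt_or_ge i N with hi | hi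
        · exact (hspike i hi).le
        · have hi' : (N : ℝ) ≤ i := by exact_mod_cast hi
          refine (abs_le_inv_of_mem_counterBody hθ i).trans ?_
          rw [div_le_iff₀ (by positivity)]
          exact hτN.trans (by gcongr)
      have h1 := norm_sq_le_of_mem_counterBody (d := d) hθ hτ.le hle
      have h2 : ε ^ 2 ≤ ‖θ‖ ^ 2 := by gcongr
      have h3 : τ / (d + 1) ≤ ε ^ 2 / 2 := by
        rw [div_le_iff₀ (by positivity)]; linarith
      linarith

end errors

/-! ### Choice of parameters -/

section rate

variable {G : (ℕ → ℝ) → Measure (ℕ → ℝ)} {ε r : ℝ}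

lemma gofFeasible_counterBody_floor (hG : ∀ θ, IsGaussianSeq θ (G θ)) (hε : 0 < ε) (hr : 2 ≤ r)
    (hεr : ε ^ 2 = (r ^ 5)⁻¹) (hl : 1000 ≤ log (16 / ε)) :
    GofFeasible G counterBody ε ⌊r ^ 6 * log (16 / ε)⌋₊ := by
  set l := log (16 / ε) with hldef
  set n := ⌊r ^ 6 * l⌋₊ with hndef
  have hr0 : 0 < r := by linarith
  have h1r (k : ℕ) : 1 ≤ r ^ k := one_le_pow₀ (by linarith)
  have hbig : 1000 ≤ r ^ 6 * l := by nlinarith [h1r 6]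
  have hn_gt : r ^ 6 * l - 1 < n := Nat.sub_one_lt_floor _
  have hn_half : r ^ 6 * l / 2 ≤ n := by linarith
  have hn0 : 0 < (n : ℝ) := by linarith
  have hN1 : r ^ 3 ≤ (⌈r ^ 3⌉₊ : ℝ) := Nat.le_ceil _
  have hN2 : (⌈r ^ 3⌉₊ : ℝ) ≤ 2 * r ^ 3 := by
    linarith [Nat.ceil_lt_add_one (show 0 ≤ r ^ 3 by positivity), h1r 3]
  have hd1 : 8 * r ^ 2 ≤ (⌈8 * r ^ 2⌉₊ : ℝ) := Nat.le_ceil _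
  have hd2 : (⌈8 * r ^ 2⌉₊ : ℝ) ≤ 9 * r ^ 2 := by
    linarith [Nat.ceil_lt_add_one (show 0 ≤ 8 * r ^ 2 by positivity), h1r 2]
  have hexp : exp (-(n * (4 / r ^ 3) ^ 2 / 8)) ≤ 3 * (ε ^ 2 / 256) := by
    have e1 : n * (4 / r ^ 3) ^ 2 / 8 = 2 * n / r ^ 6 := by field_simp; norm_num
    have e2 : 2 * l - 1 ≤ n * (4 / r ^ 3) ^ 2 / 8 := by
      rw [e1, le_div_iff₀ (by positivity)]
      linarith [le_self_pow₀ (by linarith : 1 ≤ r) (by norm_num : 6 ≠ 0)]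
    calc exp (-(n * (4 / r ^ 3) ^ 2 / 8)) ≤ exp (1 + (-l + -l)) := by gcongr; linarith
      _ = exp 1 * (ε ^ 2 / 256) := by
        rw [exp_add, exp_add, exp_neg, hldef, exp_log (by positivity)]
        field_simp; norm_num
      _ ≤ 3 * (ε ^ 2 / 256) := by gcongr; linarith [exp_one_lt_d9]
  have hfour : ε ^ 4 = (r ^ 10)⁻¹ := by
    rw [show ε ^ 4 = (ε ^ 2) ^ 2 by ring, hεr, inv_pow, ← pow_mul]
  have hquad : 32 * (⌈8 * r ^ 2⌉₊ : ℝ) / (n ^ 2 * ε ^ 4) ≤ 1 / 8 := by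
    calc 32 * (⌈8 * r ^ 2⌉₊ : ℝ) / (n ^ 2 * ε ^ 4)
        ≤ 32 * (9 * r ^ 2) / ((r ^ 6 * l / 2) ^ 2 * ε ^ 4) := by gcongr
      _ = 1152 / l ^ 2 := by rw [hfour]; field_simp; norm_num
      _ ≤ 1152 / 1000 ^ 2 := by gcongr
      _ ≤ 1 / 8 := by norm_num
  have hlin : 32 / (n * ε ^ 2) ≤ 1 / 8 := by
    calc 32 / (n * ε ^ 2) ≤ 32 / ((r ^ 6 * l / 2) * ε ^ 2) := by gcongr
      _ = 64 / (r * l) := by rw [hεr]; field_simp; norm_num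
      _ ≤ 64 / (1 * 1000) := by gcongr; linarith
      _ ≤ 1 / 8 := by norm_num
  refine gofFeasible_counterBody hG (N := ⌈r ^ 3⌉₊) (d := ⌈8 * r ^ 2⌉₊) (τ := 4 / r ^ 3)
    (by exact_mod_cast hn0) (Nat.ceil_pos.2 (by positivity)) (by positivity) hε ?_ ?_ ?_
    (by linarith)
  · rw [div_mul_eq_mul_div, le_div_iff₀ (by positivity)]
    linarith
  · calc 2 * (4 / r ^ 3) = (r ^ 5)⁻¹ * (8 * r ^ 2) := by field_simp; norm_num
      _ ≤ ε ^ 2 * (⌈8 * r ^ 2⌉₊ + 1) := by rw [hεr]; gcongr; linarith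
  · have : 2 * (⌈r ^ 3⌉₊ : ℝ) * exp (-(n * (4 / r ^ 3) ^ 2 / 8)) ≤ 1 / 8 := by
      calc 2 * (⌈r ^ 3⌉₊ : ℝ) * exp (-(n * (4 / r ^ 3) ^ 2 / 8))
          ≤ 2 * (2 * r ^ 3) * (3 * (ε ^ 2 / 256)) := by gcongr
        _ = 3 / 64 / r ^ 2 := by rw [hεr]; field_simp; norm_num
        _ ≤ 3 / 64 / 1 := by gcongr; exact h1r 2
        _ ≤ 1 / 8 := by norm_num
    linarith

lemma not_gofFeasible_counterBody_of_le (hG : ∀ θ, IsGaussianSeq θ (G θ)) (hr : 100 ≤ r)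
    (hεr : ε ^ 2 = (r ^ 5)⁻¹) {n : ℕ} (hn : (n : ℝ) ≤ r ^ 6 / 64) :
    ¬ GofFeasible G counterBody ε n := by
  have hr0 : 0 < r := by linarith
  have hs1 : r ≤ (⌈r⌉₊ : ℝ) := Nat.le_ceil _
  have hs2 : (⌈r⌉₊ : ℝ) ≤ 101 / 100 * r := by linarith [Nat.ceil_lt_add_one hr0.le]
  have hm1 : (⌊r / 2⌋₊ : ℝ) ≤ r / 2 := Nat.floor_le (by positivity)
  have hm2 : 49 / 100 * r ≤ (⌊r / 2⌋₊ : ℝ) := by linarith [Nat.sub_one_lt_floor (r / 2)]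
  refine not_gofFeasible_counterBody hG (τ := 1 / r ^ 3) (s := ⌈r⌉₊) (m := ⌊r / 2⌋₊)
    (by positivity) (Nat.floor_pos.2 (by linarith)) ?_ ?_ ?_
  · calc ε ^ 2 = r * (1 / r ^ 3) ^ 2 := by rw [hεr]; field_simp
      _ ≤ _ := by gcongr
  · calc 1 / r ^ 3 * ⌈r⌉₊ * (⌈r⌉₊ * ⌊r / 2⌋₊)
        ≤ 1 / r ^ 3 * (101 / 100 * r) * ((101 / 100 * r) * (r / 2)) := by gcongr
      _ = (101 / 100) ^ 2 / 2 := by field_simp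
      _ ≤ 1 := by norm_num
  · have h1 : n * (1 / r ^ 3) ^ 2 ≤ 1 / 64 := by
      calc n * (1 / r ^ 3) ^ 2 ≤ r ^ 6 / 64 * (1 / r ^ 3) ^ 2 := by gcongr
        _ = 1 / 64 := by field_simp
    have h2 : exp (n * (1 / r ^ 3) ^ 2) - 1 ≤ 1 / 32 := by
      have := abs_exp_sub_one_le (x := (1 / 64 : ℝ)) (by norm_num [abs_of_pos])
      have h3 := le_abs_self (exp (1 / 64) - 1)
      have h4 := exp_le_exp.2 h1
      rw [abs_of_pos (by norm_num : (0 : ℝ) < 1 / 64)] at this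
      linarith
    calc (⌈r⌉₊ : ℝ) * (exp (n * (1 / r ^ 3) ^ 2) - 1) ≤ 101 / 100 * r * (1 / 32) :=
          mul_le_mul hs2 h2 (sub_nonneg.2 (one_le_exp (by positivity))) (by positivity)
      _ ≤ _ := by linarith

end rate

/-- For `Γ = {θ : Σ_i i |θ_i| ≤ 1}`, the goodness-of-fit testing sample complexity is
`Θ̃(ε^{−12/5})`: bounded between `c ε^{−12/5}` and `C ε^{−12/5} log(1/ε)`, and in
particular strictly above `ε^{−12/5}/64` and at most `ε^{−12/5} log(16/ε)`, for small `ε`. -/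
theorem counterexample_gof_rate (G : (ℕ → ℝ) → Measure (ℕ → ℝ))
    (hG : ∀ θ : ℕ → ℝ, IsGaussianSeq θ (G θ)) :
    ∃ c C ε₀ : ℝ, 0 < c ∧ 0 < C ∧ ε₀ ∈ Set.Ioo (0 : ℝ) 1 ∧
      ∀ ε : ℝ, ε ∈ Set.Ioo (0 : ℝ) ε₀ →
        (c * ε ^ (-(12 : ℝ)/5) ≤ (nGofSeq G counterBody ε : ℝ) ∧
         (nGofSeq G counterBody ε : ℝ) ≤ C * ε ^ (-(12 : ℝ)/5) * Real.log (1/ε) ∧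
         ε ^ (-(12 : ℝ)/5) / 64 < (nGofSeq G counterBody ε : ℝ) ∧
         (nGofSeq G counterBody ε : ℝ) ≤ ε ^ (-(12 : ℝ)/5) * Real.log (16/ε)) := by
  refine ⟨1 / 64, 2, exp (-1000), by norm_num, by norm_num,
    ⟨exp_pos _, by simp⟩, fun ε ⟨hε, hε₀⟩ => ?_⟩
  have hlog : 1000 ≤ log (1 / ε) := by
    rw [one_div, log_inv]
    linarith [(log_lt_iff_lt_exp hε).2 hε₀]
  have hlog16 : log (16 / ε) = log 16 + log (1 / ε) := by
    rw [← log_mul (by norm_num) (by positivity)]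
    congr 1; ring
  have h16 : 0 ≤ log (16 : ℝ) ∧ log (16 : ℝ) ≤ 15 :=
    ⟨log_nonneg (by norm_num), (log_le_sub_one_of_pos (by norm_num)).trans (by norm_num)⟩
  set r := ε ^ (-(2 : ℝ) / 5) with hr
  have hr0 : 0 < r := rpow_pos_of_pos hε _
  have hr100 : 100 ≤ r := by
    rw [hr, rpow_def_of_pos hε]
    rw [one_div, log_inv] at hlog
    linarith [add_one_le_exp (log ε * (-2 / 5))]
  have hr6 : ε ^ (-(12 : ℝ) / 5) = r ^ 6 := by
    rw [hr, ← rpow_natCast, ← rpow_mul hε.le]; norm_num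
  have hr5 : ε ^ 2 = (r ^ 5)⁻¹ := by
    rw [hr, ← rpow_natCast, ← rpow_natCast, ← rpow_mul hε.le, ← rpow_neg hε.le]; norm_num
  have hfeas := gofFeasible_counterBody_floor hG hε (by linarith) hr5 (by linarith)
  have hle : (nGofSeq G counterBody ε : ℝ) ≤ r ^ 6 * log (16 / ε) := by
    refine le_trans (Nat.cast_le.2 (Nat.sInf_le hfeas)) (Nat.floor_le ?_)
    have : 0 ≤ log (16 / ε) := by linarith
    positivity
  have hlt : r ^ 6 / 64 < (nGofSeq G counterBody ε : ℝ) := by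
    by_contra! h
    exact not_gofFeasible_counterBody_of_le hG hr100 hr5 h
      (Nat.sInf_mem (s := {n | GofFeasible G counterBody ε n}) ⟨_, hfeas⟩)
  rw [hr6]
  refine ⟨by linarith, hle.trans ?_, hlt, hle⟩
  rw [mul_comm 2, mul_assoc]
  gcongr
  linarith
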